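/- Let (A,m) be a Noetherian local ring, M a finitely generated A-module, and x ∈ m \ m² an element whose initial form x* ∈ m/m² ⊆ G(A) is a nonzerodivisor on the associated graded module G(M) = ⊕_{n≥0} m^n M/m^{n+1} M. Set N = M/xM. Then the natural surjective graded map G(M)/x*G(M) → G(N) is an isomorphism; equivalently, for every n ≥ 0, xM ∩ m^{n+1}M = x(m^n M). -/

import Mathlib

open Submodule IsLocalRing

lemma smul_mem_pow_succ {R M : Type*} [CommRing R] [AddCommGroup M] [Module R M]
    (I : Ideal R) {x : R} (hx : x ∈ I) (n : ℕ) {v : M}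
    (hv : v ∈ I ^ n • (⊤ : Submodule R M)) :
    x • v ∈ I ^ (n + 1) • (⊤ : Submodule R M) := by
  have h : I ^ (n + 1) • (⊤ : Submodule R M) = I • I ^ n • (⊤ : Submodule R M) := by
    rw [← Submodule.smul_assoc, smul_eq_mul, pow_succ']
  rw [h]
  exact Submodule.smul_mem_smul hx hv

/-- Multiplication by the initial form of `x ∈ I`, from the `n`-th graded piece
`I^n M/I^{n+1} M` of the associated graded module `G(M)` to the `(n+1)`-st graded piece. -/
noncomputable def gradedPieceMul {R M : Type*} [CommRing R] [AddCommGroup M] [Module R M]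
    (I : Ideal R) (x : R) (hx : x ∈ I) (n : ℕ) :
    (↥(I ^ n • (⊤ : Submodule R M)) ⧸
      (comap (I ^ n • (⊤ : Submodule R M)).subtype (I ^ (n + 1) • (⊤ : Submodule R M)))) →ₗ[R]
    (↥(I ^ (n + 1) • (⊤ : Submodule R M)) ⧸
      (comap (I ^ (n + 1) • (⊤ : Submodule R M)).subtype (I ^ (n + 2) • (⊤ : Submodule R M)))) :=
  Submodule.mapQ _ _
    ((x • (LinearMap.id : M →ₗ[R] M)).restrict
      (fun v hv => smul_mem_pow_succ I hx n hv))
    (by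
      intro v hv
      simp only [Submodule.mem_comap] at hv ⊢
      exact smul_mem_pow_succ I hx (n + 1) hv)

/-- If `x*` is a nonzerodivisor on the associated graded module, then multiplication by `x`
raises the order of an element by exactly one. -/
lemma mem_pow_smul_top_of_smul_mem {R M : Type*} [CommRing R] [AddCommGroup M] [Module R M]
    (I : Ideal R) {x : R} (hx : x ∈ I)
    (hreg : ∀ n : ℕ, Function.Injective (gradedPieceMul (M := M) I x hx n)) (n : ℕ) {v : M}
    (hv : x • v ∈ I ^ (n + 1) • (⊤ : Submodule R M)) :
    v ∈ I ^ n • (⊤ : Submodule R M) := by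
  induction n with
  | zero => simp
  | succ n ih =>
    have hvn : v ∈ I ^ n • (⊤ : Submodule R M) :=
      ih (Submodule.smul_mono_left (Ideal.pow_le_pow_right (by omega)) hv)
    have hker : gradedPieceMul I x hx n (Submodule.Quotient.mk ⟨v, hvn⟩) = 0 :=
      (Submodule.Quotient.mk_eq_zero _).2 hv
    have hzero := (map_eq_zero_iff _ (hreg n)).1 hker
    rwa [Submodule.Quotient.mk_eq_zero] at hzero

/-- Let `(A,𝔪)` be a Noetherian local ring, `M` a finitely generated `A`-module and
`x ∈ 𝔪 \ 𝔪²` an element whose initial form `x*` is a nonzerodivisor on `G(M)` (i.e.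
multiplication by `x*` is injective in each degree).  Then `G(M)/x*G(M) ≅ G(M/xM)`;
equivalently, `xM ∩ 𝔪^{n+1}M = x·(𝔪^n M)` for every `n ≥ 0`. -/
theorem graded_quotient_of_initial_form_regular
    (A : Type*) [CommRing A] [IsNoetherianRing A] [IsLocalRing A]
    (M : Type*) [AddCommGroup M] [Module A M] [Module.Finite A M]
    (x : A) (hx : x ∈ maximalIdeal A) (hx2 : x ∉ (maximalIdeal A) ^ 2)
    (hreg : ∀ n : ℕ, Function.Injective (gradedPieceMul (M := M) (maximalIdeal A) x hx n)) :
    ∀ n : ℕ,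
      (Submodule.map (x • (LinearMap.id : M →ₗ[A] M)) ⊤) ⊓
          ((maximalIdeal A) ^ (n + 1) • (⊤ : Submodule A M)) =
        Submodule.map (x • (LinearMap.id : M →ₗ[A] M))
          ((maximalIdeal A) ^ n • (⊤ : Submodule A M)) := by
  intro n
  apply le_antisymm
  · rintro _ ⟨⟨v, -, rfl⟩, hv⟩
    exact ⟨v, mem_pow_smul_top_of_smul_mem _ hx hreg n hv, rfl⟩
  · rintro _ ⟨v, hv, rfl⟩
    exact ⟨⟨v, trivial, rfl⟩, smul_mem_pow_succ _ hx n hv⟩
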